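/- Let H be a complex Hilbert space, let Y be a Banach space, let a, b ∈ B(H) be bounded operators satisfying a b* = 0 (where b* is the Hilbert space adjoint), and let f, g ∈ B(H, Y) be bounded operators. Then ‖f ∘ a + g ∘ b‖² ≤ ‖f ∘ a‖² + ‖g ∘ b‖². -/

import Mathlib

open ContinuousLinearMap in
/-- If `a b* = 0`, then `b` vanishes on the orthogonal complement of the kernel of `a`. -/
theorem apply_eq_zero_of_mem_ker_orthogonal {H : Type*}
    [NormedAddCommGroup H] [InnerProductSpace ℂ H] [CompleteSpace H]
    {a b : H →L[ℂ] H} (hab : a.comp (adjoint b) = 0)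
    {z : H} (hz : z ∈ (LinearMap.ker a.toLinearMap)ᗮ) : b z = 0 := by
  have hker : adjoint b (b z) ∈ LinearMap.ker a.toLinearMap := by
    exact DFunLike.congr_fun hab (b z)
  have h := (Submodule.mem_orthogonal _ _).1 hz _ hker
  rwa [adjoint_inner_left, inner_self_eq_zero] at h

/-- Let `H` be a complex Hilbert space, `Y` a Banach space,
`a, b ∈ B(H)` with `a b* = 0`, and `f, g ∈ B(H, Y)`.
Then `‖f ∘ a + g ∘ b‖² ≤ ‖f ∘ a‖² + ‖g ∘ b‖²`. -/
theorem bessel_right {H Y : Type*}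
    [NormedAddCommGroup H] [InnerProductSpace ℂ H] [CompleteSpace H]
    [NormedAddCommGroup Y] [NormedSpace ℂ Y] [CompleteSpace Y]
    (a b : H →L[ℂ] H) (hab : a.comp (ContinuousLinearMap.adjoint b) = 0)
    (f g : H →L[ℂ] Y) :
    ‖f.comp a + g.comp b‖ ^ 2 ≤ ‖f.comp a‖ ^ 2 + ‖g.comp b‖ ^ 2 := by
  set A := ‖f.comp a‖
  set B := ‖g.comp b‖
  have : CompleteSpace (LinearMap.ker a.toLinearMap) := a.isClosed_ker.completeSpace_coe
  suffices h : ‖f.comp a + g.comp b‖ ≤ √(A ^ 2 + B ^ 2) from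
    (Real.le_sqrt (norm_nonneg _) (by positivity)).1 h
  refine ContinuousLinearMap.opNorm_le_bound _ (Real.sqrt_nonneg _) fun x => ?_
  obtain ⟨y, hy, z, hz, rfl⟩ :=
    (LinearMap.ker a.toLinearMap).exists_add_mem_mem_orthogonal x
  have hay : a y = 0 := hy
  have hbz : b z = 0 := apply_eq_zero_of_mem_ker_orthogonal hab hz
  have hsplit : (f.comp a + g.comp b) (y + z) = f.comp a z + g.comp b y := by
    simp [hay, hbz]
  have hnorm := norm_add_sq_eq_norm_sq_add_norm_sq_of_inner_eq_zero y z
    ((Submodule.mem_orthogonal _ _).1 hz y hy)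
  calc ‖(f.comp a + g.comp b) (y + z)‖ ≤ A * ‖z‖ + B * ‖y‖ := by
        rw [hsplit]
        exact norm_add_le_of_le ((f.comp a).le_opNorm z) ((g.comp b).le_opNorm y)
    _ ≤ √((A ^ 2 + B ^ 2) * ‖y + z‖ ^ 2) := by
        apply Real.le_sqrt_of_sq_le
        rw [sq ‖y + z‖, hnorm]
        linarith [sq_nonneg (A * ‖y‖ - B * ‖z‖)]
    _ = √(A ^ 2 + B ^ 2) * ‖y + z‖ := by
        rw [Real.sqrt_mul (by positivity), Real.sqrt_sq (norm_nonneg _)]
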